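/- Let G be a finite simple graph containing a vertex v of degree 10 with distinct neighbors u_1, …, u_10 such that u_i u_{i+1} ∈ E(G) for i = 1, …, 9 and u_10 u_1 ∉ E(G) (so {v, u_1, …, u_10} is a 10-fan with hub v that is not a wheel). Suppose d(u_1) = d(u_3) = d(u_5) = d(u_7) = d(u_9) = 3 and {u_1, u_3, u_5, u_7, u_9} is an independent set in G. Then there exists a set B of at most 8 edges of G such that γ_i(G − B) > γ_i(G); that is, b_i(G) ≤ 8. -/

import Mathlib

open scoped BigOperators

/-- A set of vertices is an independent dominating set: it is independent
(no two of its vertices are adjacent) and dominating (every vertex is in it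
or adjacent to a vertex in it). -/
def SimpleGraph.IsIndepDomSet {V : Type*} (G : SimpleGraph V) (S : Set V) : Prop :=
  (∀ u ∈ S, ∀ w ∈ S, ¬ G.Adj u w) ∧ ∀ x, x ∈ S ∨ ∃ u ∈ S, G.Adj u x

/-- The independent domination number: the minimum cardinality of an
independent dominating set. -/
noncomputable def SimpleGraph.indepDomNum {V : Type*} (G : SimpleGraph V) : ℕ :=
  sInf {n | ∃ S : Set V, G.IsIndepDomSet S ∧ S.ncard = n}

namespace SimpleGraph

variable {V : Type*}

theorem IsIndepDomSet.indepDomNum_le {G : SimpleGraph V} {S : Set V} (h : G.IsIndepDomSet S) :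
    G.indepDomNum ≤ S.ncard :=
  Nat.sInf_le ⟨S, h, rfl⟩

theorem exists_isIndepDomSet [Finite V] (G : SimpleGraph V) : ∃ S : Set V, G.IsIndepDomSet S := by
  obtain ⟨S, hS⟩ := Set.Finite.exists_maximal
    (Set.toFinite {S : Set V | ∀ u ∈ S, ∀ w ∈ S, ¬ G.Adj u w}) ⟨∅, by simp⟩
  refine ⟨S, hS.prop, fun x => ?_⟩
  by_contra! hx
  refine hx.1 (hS.le_of_ge (y := insert x S) ?_ (Set.subset_insert x S) (Set.mem_insert x S))
  rintro a (rfl | ha) b (rfl | hb) hab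
  · exact G.loopless.irrefl _ hab
  · exact hx.2 b hb hab.symm
  · exact hx.2 a ha hab
  · exact hS.prop a ha b hb hab

theorem indepDomNum_lt_of_forall [Finite V] {G H : SimpleGraph V}
    (h : ∀ S, H.IsIndepDomSet S → ∃ T, G.IsIndepDomSet T ∧ T.ncard < S.ncard) :
    G.indepDomNum < H.indepDomNum := by
  obtain ⟨S₀, hS₀⟩ := H.exists_isIndepDomSet
  obtain ⟨S, hS, hcard⟩ : H.indepDomNum ∈ {n | ∃ S : Set V, H.IsIndepDomSet S ∧ S.ncard = n} :=
    Nat.sInf_mem ⟨_, S₀, hS₀, rfl⟩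
  obtain ⟨T, hT, hlt⟩ := h S hS
  exact hcard ▸ hT.indepDomNum_le.trans_lt hlt

theorem eq_of_adj_of_ncard_neighborSet_eq_three [Finite V] {G : SimpleGraph V} {a x y z w : V}
    (hcard : (G.neighborSet a).ncard = 3) (hx : G.Adj a x) (hy : G.Adj a y) (hz : G.Adj a z)
    (hxy : x ≠ y) (hxz : x ≠ z) (hyz : y ≠ z) (hw : G.Adj a w) : w = x ∨ w = y ∨ w = z := by
  have hsub : ({x, y, z} : Set V) ⊆ G.neighborSet a := by
    rintro t (rfl | rfl | rfl) <;> assumption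
  have heq : ({x, y, z} : Set V) = G.neighborSet a := by
    refine Set.eq_of_subset_of_ncard_le hsub ?_
    rw [hcard, Set.ncard_eq_three.mpr ⟨x, y, z, hxy, hxz, hyz, rfl⟩]
  have hw' : w ∈ ({x, y, z} : Set V) := heq ▸ hw
  simpa using hw'

end SimpleGraph

theorem stmt13 {V : Type*} [Fintype V]
    (G : SimpleGraph V) (v : V) (u : Fin 10 → V)
    (hinj : Function.Injective u)
    (hdeg : (G.neighborSet v).ncard = 10)
    (hnbr : ∀ i, G.Adj v (u i))
    (hpath : ∀ i : Fin 10, i.val < 9 → G.Adj (u i) (u (i + 1)))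
    (hnotwheel : ¬ G.Adj (u 9) (u 0))
    (hd1 : (G.neighborSet (u 0)).ncard = 3)
    (hd3 : (G.neighborSet (u 2)).ncard = 3)
    (hd5 : (G.neighborSet (u 4)).ncard = 3)
    (hd7 : (G.neighborSet (u 6)).ncard = 3)
    (hd9 : (G.neighborSet (u 8)).ncard = 3)
    (hind : ∀ i ∈ ({0, 2, 4, 6, 8} : Finset (Fin 10)),
      ∀ j ∈ ({0, 2, 4, 6, 8} : Finset (Fin 10)), ¬ G.Adj (u i) (u j)) :
    ∃ B : Finset (Sym2 V), ↑B ⊆ G.edgeSet ∧ B.card ≤ 8 ∧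
      G.indepDomNum < (G.deleteEdges ↑B).indepDomNum := by
  classical
  have hdist : ∀ i j, i ≠ j → u i ≠ u j := fun i j h => hinj.ne h
  have hvu : ∀ i, u i ≠ v := fun i => (hnbr i).ne'
  have hv : ∀ w, G.Adj v w → ∃ i, u i = w := by
    have heq : Set.range u = G.neighborSet v := by
      refine Set.eq_of_subset_of_ncard_le (Set.range_subset_iff.mpr hnbr) ?_
      rw [hdeg, ← Set.image_univ, Set.ncard_image_of_injective _ hinj, Set.ncard_univ]
      simp
    intro w hw
    exact heq.symm.subset hw
  have p01 : G.Adj (u 0) (u 1) := hpath 0 (by decide)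
  have p12 : G.Adj (u 1) (u 2) := hpath 1 (by decide)
  have p23 : G.Adj (u 2) (u 3) := hpath 2 (by decide)
  have p34 : G.Adj (u 3) (u 4) := hpath 3 (by decide)
  have p45 : G.Adj (u 4) (u 5) := hpath 4 (by decide)
  have p56 : G.Adj (u 5) (u 6) := hpath 5 (by decide)
  have p67 : G.Adj (u 6) (u 7) := hpath 6 (by decide)
  have p78 : G.Adj (u 7) (u 8) := hpath 7 (by decide)
  have p89 : G.Adj (u 8) (u 9) := hpath 8 (by decide)
  have n2 : ∀ w, G.Adj (u 2) w → w = v ∨ w = u 1 ∨ w = u 3 := fun w =>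
    SimpleGraph.eq_of_adj_of_ncard_neighborSet_eq_three hd3 (hnbr 2).symm p12.symm p23
      (hvu _).symm (hvu _).symm (hdist _ _ (by decide))
  have n4 : ∀ w, G.Adj (u 4) w → w = v ∨ w = u 3 ∨ w = u 5 := fun w =>
    SimpleGraph.eq_of_adj_of_ncard_neighborSet_eq_three hd5 (hnbr 4).symm p34.symm p45
      (hvu _).symm (hvu _).symm (hdist _ _ (by decide))
  have n6 : ∀ w, G.Adj (u 6) w → w = v ∨ w = u 5 ∨ w = u 7 := fun w =>
    SimpleGraph.eq_of_adj_of_ncard_neighborSet_eq_three hd7 (hnbr 6).symm p56.symm p67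
      (hvu _).symm (hvu _).symm (hdist _ _ (by decide))
  have n8 : ∀ w, G.Adj (u 8) w → w = v ∨ w = u 7 ∨ w = u 9 := fun w =>
    SimpleGraph.eq_of_adj_of_ncard_neighborSet_eq_three hd9 (hnbr 8).symm p78.symm p89
      (hvu _).symm (hvu _).symm (hdist _ _ (by decide))
  have n0 : ∀ y z, G.Adj (u 0) y → G.Adj (u 0) z → y ≠ v → y ≠ u 1 → z ≠ v → z ≠ u 1 → z = y := by
    intro y z hy hz hyv hy1 hzv hz1
    have := SimpleGraph.eq_of_adj_of_ncard_neighborSet_eq_three hd1 (hnbr 0).symm p01 hy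
      (hvu _).symm hyv.symm hy1.symm hz
    tauto
  let B : Finset (Sym2 V) := {s(u 4, v), s(u 4, u 3), s(u 4, u 5), s(u 8, v), s(u 8, u 7),
    s(u 8, u 9), s(v, u 1), s(v, u 6)}
  have hBsub : (B : Set (Sym2 V)) ⊆ G.edgeSet := by
    intro e he
    simp only [B, Finset.coe_insert, Finset.coe_singleton, Set.mem_insert_iff,
      Set.mem_singleton_iff] at he
    rcases he with rfl | rfl | rfl | rfl | rfl | rfl | rfl | rfl <;>
      simp only [SimpleGraph.mem_edgeSet]
    exacts [(hnbr 4).symm, p34.symm, p45, (hnbr 8).symm, p78.symm, p89, hnbr 1, hnbr 6]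
  refine ⟨B, hBsub, ?_, SimpleGraph.indepDomNum_lt_of_forall fun S hS => ?_⟩
  · exact (Finset.card_insert_le _ _).trans (Nat.succ_le_succ
      ((Finset.card_insert_le _ _).trans (Nat.succ_le_succ Finset.card_le_six)))
  set H := G.deleteEdges (B : Set (Sym2 V)) with hHdef
  have hHG : ∀ a b, H.Adj a b → G.Adj a b := fun a b h => (SimpleGraph.deleteEdges_adj.mp h).1
  have hGH : ∀ a b, G.Adj a b → a ≠ u 4 → b ≠ u 4 → a ≠ u 8 → b ≠ u 8 →
      (a = v → b ≠ u 1 ∧ b ≠ u 6) → (b = v → a ≠ u 1 ∧ a ≠ u 6) → H.Adj a b := by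
    intro a b hab ha4 hb4 ha8 hb8 hav hbv
    refine SimpleGraph.deleteEdges_adj.mpr ⟨hab, ?_⟩
    simp only [B, Finset.coe_insert, Finset.coe_singleton, Set.mem_insert_iff,
      Set.mem_singleton_iff, Sym2.eq_iff]
    grind
  have hmiss : ∀ a b, G.Adj a b → ¬ H.Adj a b → a ≠ v → b ≠ v →
      (a = u 4 ∧ (b = u 3 ∨ b = u 5)) ∨ (a = u 8 ∧ (b = u 7 ∨ b = u 9)) ∨
      (b = u 4 ∧ (a = u 3 ∨ a = u 5)) ∨ (b = u 8 ∧ (a = u 7 ∨ a = u 9)) := by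
    intro a b hab hH hav hbv
    by_cases ha4 : a = u 4
    · exact .inl ⟨ha4, (n4 b (ha4 ▸ hab)).resolve_left hbv⟩
    by_cases ha8 : a = u 8
    · exact .inr (.inl ⟨ha8, (n8 b (ha8 ▸ hab)).resolve_left hbv⟩)
    by_cases hb4 : b = u 4
    · exact .inr (.inr (.inl ⟨hb4, (n4 a (hb4 ▸ hab.symm)).resolve_left hav⟩))
    by_cases hb8 : b = u 8
    · exact .inr (.inr (.inr ⟨hb8, (n8 a (hb8 ▸ hab.symm)).resolve_left hav⟩))
    exact absurd (hGH a b hab ha4 hb4 ha8 hb8 (absurd · hav) (absurd · hbv)) hH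
  have hH4 : ∀ w, ¬ H.Adj (u 4) w := by
    intro w hw
    obtain ⟨hG, hB⟩ := SimpleGraph.deleteEdges_adj.mp hw
    rcases n4 w hG with rfl | rfl | rfl <;> simp [B] at hB
  have hH8 : ∀ w, ¬ H.Adj (u 8) w := by
    intro w hw
    obtain ⟨hG, hB⟩ := SimpleGraph.deleteEdges_adj.mp hw
    rcases n8 w hG with rfl | rfl | rfl <;> simp [B] at hB
  have hH1 : ¬ H.Adj v (u 1) := fun h => by
    have hB := (SimpleGraph.deleteEdges_adj.mp h).2
    simp [B] at hB
  have hH6 : ¬ H.Adj v (u 6) := fun h => by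
    have hB := (SimpleGraph.deleteEdges_adj.mp h).2
    simp [B] at hB
  clear_value H
  clear hHdef hBsub hnotwheel hd1 hd3 hd5 hd7 hd9 hind hdeg hpath
  obtain ⟨hSi, hSd⟩ := hS
  have h4 : u 4 ∈ S := (hSd (u 4)).resolve_right fun ⟨w, _, hw⟩ => hH4 w hw.symm
  have h8 : u 8 ∈ S := (hSd (u 8)).resolve_right fun ⟨w, _, hw⟩ => hH8 w hw.symm
  by_cases hvS : v ∈ S
  · have hnot : ∀ i, i ≠ 1 → i ≠ 4 → i ≠ 6 → i ≠ 8 → u i ∉ S := by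
      intro i i1 i4 i6 i8 hi
      exact hSi v hvS _ hi (hGH _ _ (hnbr i) (hvu _).symm (hdist _ _ i4) (hvu _).symm
        (hdist _ _ i8) (fun _ => ⟨hdist _ _ i1, hdist _ _ i6⟩) fun h => absurd h (hvu _))
    have h6 : u 6 ∈ S := by
      refine (hSd (u 6)).resolve_right ?_
      rintro ⟨w, hw, hadj⟩
      rcases n6 w (hHG _ _ hadj.symm) with rfl | rfl | rfl
      · exact hH6 hadj
      · exact hnot 5 (by decide) (by decide) (by decide) (by decide) hw
      · exact hnot 7 (by decide) (by decide) (by decide) (by decide) hw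
    by_cases h1 : u 1 ∈ S
    · refine ⟨S \ {v}, ⟨?_, ?_⟩, Set.ncard_sdiff_singleton_lt_of_mem hvS⟩
      · rintro a ⟨ha, hav⟩ b ⟨hb, hbv⟩ hab
        have h3 := hnot 3 (by decide) (by decide) (by decide) (by decide)
        have h5 := hnot 5 (by decide) (by decide) (by decide) (by decide)
        have h7 := hnot 7 (by decide) (by decide) (by decide) (by decide)
        have h9 := hnot 9 (by decide) (by decide) (by decide) (by decide)
        rcases hmiss a b hab (hSi a ha b hb) hav hbv with
          ⟨-, rfl | rfl⟩ | ⟨-, rfl | rfl⟩ | ⟨-, rfl | rfl⟩ | ⟨-, rfl | rfl⟩ <;> contradiction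
      · have hmem : ∀ i, u i ∈ S → u i ∈ S \ {v} := fun i hi => ⟨hi, hvu i⟩
        have hfan : ∀ i, u i ∈ S \ {v} ∨ ∃ w ∈ S \ {v}, G.Adj w (u i) := by
          intro i
          fin_cases i
          exacts [.inr ⟨_, hmem _ h1, p01.symm⟩, .inl (hmem _ h1), .inr ⟨_, hmem _ h1, p12⟩,
            .inr ⟨_, hmem _ h4, p34.symm⟩, .inl (hmem _ h4), .inr ⟨_, hmem _ h4, p45⟩,
            .inl (hmem _ h6), .inr ⟨_, hmem _ h6, p67⟩, .inl (hmem _ h8),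
            .inr ⟨_, hmem _ h8, p89⟩]
        intro x
        by_cases hxv : x = v
        · exact .inr ⟨_, hmem _ h1, hxv.symm ▸ (hnbr 1).symm⟩
        rcases hSd x with hx | ⟨w, hw, hadj⟩
        · exact .inl ⟨hx, hxv⟩
        · by_cases hwv : w = v
          · obtain ⟨i, rfl⟩ := hv x (hwv ▸ hHG _ _ hadj)
            exact hfan i
          · exact .inr ⟨w, ⟨hw, hwv⟩, hHG _ _ hadj⟩
    · refine ⟨S \ {u 4, u 6, u 8}, ⟨?_, ?_⟩,
        Set.ncard_lt_ncard (Set.sdiff_ssubset_left_iff.mpr ⟨u 4, h4, by simp⟩)⟩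
      · have hfan : ∀ w ∈ S \ {u 4, u 6, u 8}, ¬ G.Adj v w := by
          rintro w ⟨hw, hw'⟩ hadj
          obtain ⟨i, rfl⟩ := hv w hadj
          simp only [Set.mem_insert_iff, Set.mem_singleton_iff, hinj.eq_iff] at hw'
          have := hnot i
          grind
        intro a ha b hb hab
        have hav : a ≠ v := fun h => hfan b hb (h ▸ hab)
        have hbv : b ≠ v := fun h => hfan a ha (h ▸ hab.symm)
        rcases hmiss a b hab (hSi a ha.1 b hb.1) hav hbv with
          ⟨rfl, -⟩ | ⟨rfl, -⟩ | ⟨rfl, -⟩ | ⟨rfl, -⟩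
        exacts [ha.2 (by simp), ha.2 (by simp), hb.2 (by simp), hb.2 (by simp)]
      · have hvT : v ∈ S \ {u 4, u 6, u 8} := by
          simp [hvS, (hvu _).symm]
        intro x
        by_cases hvx : G.Adj v x
        · exact .inr ⟨v, hvT, hvx⟩
        have hne : ∀ i, x ≠ u i := fun i h => hvx (h ▸ hnbr i)
        rcases hSd x with hx | ⟨w, hw, hadj⟩
        · exact .inl ⟨hx, by simp [hne]⟩
        · by_cases hxv : x = v
          · exact .inl (hxv ▸ hvT)
          refine .inr ⟨w, ⟨hw, ?_⟩, hHG _ _ hadj⟩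
          rintro (rfl | rfl | rfl)
          · exact hH4 _ hadj
          · rcases n6 x (hHG _ _ hadj) with h | h | h
            exacts [hxv h, hne _ h, hne _ h]
          · exact hH8 _ hadj
  · by_cases hdrop : (u 3 ∈ S ∨ u 5 ∈ S) ∨ (u 7 ∈ S ∨ u 9 ∈ S)
    · let T : Set V := {x | x ∈ S ∧ ¬ (x = u 4 ∧ (u 3 ∈ S ∨ u 5 ∈ S)) ∧
        ¬ (x = u 8 ∧ (u 7 ∈ S ∨ u 9 ∈ S))}
      have hmem : ∀ x ∈ S, x ≠ u 4 → x ≠ u 8 → x ∈ T := fun x hx hx4 hx8 =>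
        ⟨hx, fun h => hx4 h.1, fun h => hx8 h.1⟩
      refine ⟨T, ⟨?_, ?_⟩, Set.ncard_lt_ncard ?_⟩
      · rintro a ⟨ha, ha4, ha8⟩ b ⟨hb, hb4, hb8⟩ hab
        have hav : a ≠ v := fun h => hvS (h ▸ ha)
        have hbv : b ≠ v := fun h => hvS (h ▸ hb)
        rcases hmiss a b hab (hSi a ha b hb) hav hbv with
          ⟨h, rfl | rfl⟩ | ⟨h, rfl | rfl⟩ | ⟨h, rfl | rfl⟩ | ⟨h, rfl | rfl⟩
        exacts [ha4 ⟨h, .inl hb⟩, ha4 ⟨h, .inr hb⟩, ha8 ⟨h, .inl hb⟩, ha8 ⟨h, .inr hb⟩,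
          hb4 ⟨h, .inl ha⟩, hb4 ⟨h, .inr ha⟩, hb8 ⟨h, .inl ha⟩, hb8 ⟨h, .inr ha⟩]
      · intro x
        rcases hSd x with hx | ⟨w, hw, hadj⟩
        · by_cases hxT : x ∈ T
          · exact .inl hxT
          refine .inr ?_
          have hx' : (x = u 4 ∧ (u 3 ∈ S ∨ u 5 ∈ S)) ∨ (x = u 8 ∧ (u 7 ∈ S ∨ u 9 ∈ S)) := by
            by_contra! hcon
            exact hxT ⟨hx, by tauto, by tauto⟩
          rcases hx' with ⟨rfl, h | h⟩ | ⟨rfl, h | h⟩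
          · exact ⟨_, hmem _ h (hdist _ _ (by decide)) (hdist _ _ (by decide)), p34⟩
          · exact ⟨_, hmem _ h (hdist _ _ (by decide)) (hdist _ _ (by decide)), p45.symm⟩
          · exact ⟨_, hmem _ h (hdist _ _ (by decide)) (hdist _ _ (by decide)), p78⟩
          · exact ⟨_, hmem _ h (hdist _ _ (by decide)) (hdist _ _ (by decide)), p89.symm⟩
        · exact .inr ⟨w, hmem w hw (fun h => hH4 _ (h ▸ hadj)) (fun h => hH8 _ (h ▸ hadj)),
            hHG _ _ hadj⟩
      · refine (Set.ssubset_iff_of_subset fun x hx => hx.1).mpr ?_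
        rcases hdrop with h | h
        · exact ⟨u 4, h4, fun hx => hx.2.1 ⟨rfl, h⟩⟩
        · exact ⟨u 8, h8, fun hx => hx.2.2 ⟨rfl, h⟩⟩
    · push Not at hdrop
      obtain ⟨⟨h3, h5⟩, h7, h9⟩ := hdrop
      have h6 : u 6 ∈ S := by
        refine (hSd (u 6)).resolve_right ?_
        rintro ⟨w, hw, hadj⟩
        rcases n6 w (hHG _ _ hadj.symm) with rfl | rfl | rfl <;> contradiction
      have h1 : u 1 ∉ S := by
        intro h1
        obtain ⟨w, hw, hadj⟩ := (hSd v).resolve_left hvS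
        obtain ⟨i, rfl⟩ := hv w (hHG _ _ hadj.symm)
        have g0 : H.Adj (u 1) (u 0) := by apply hGH _ _ p01.symm <;> simp [hinj.eq_iff, hvu]
        have g2 : H.Adj (u 1) (u 2) := by apply hGH _ _ p12 <;> simp [hinj.eq_iff, hvu]
        fin_cases i
        exacts [hSi _ h1 _ hw g0, hH1 hadj.symm, hSi _ h1 _ hw g2, h3 hw, hH4 _ hadj, h5 hw,
          hH6 hadj.symm, h7 hw, hH8 _ hadj, h9 hw]
      have h2 : u 2 ∈ S := by
        refine (hSd (u 2)).resolve_right ?_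
        rintro ⟨w, hw, hadj⟩
        rcases n2 w (hHG _ _ hadj.symm) with rfl | rfl | rfl <;> contradiction
      let A : Set V := u '' {0, 2, 4, 6, 8}
      have hA : ∀ w ∈ S, G.Adj v w → w ∈ A := by
        intro w hw hadj
        obtain ⟨i, rfl⟩ := hv w hadj
        refine Set.mem_image_of_mem u ?_
        fin_cases i
        exacts [by simp, absurd hw h1, by simp, absurd hw h3, by simp, absurd hw h5, by simp,
          absurd hw h7, by simp, absurd hw h9]
      let R : Set V := insert v (S \ A)
      have hcard : R.ncard + 3 ≤ S.ncard := by
        have hsub : u '' {2, 4, 6, 8} ⊆ S := by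
          rintro _ ⟨i, rfl | rfl | rfl | rfl, rfl⟩ <;> assumption
        have hfour : (u '' {2, 4, 6, 8}).ncard = 4 := by
          rw [Set.ncard_image_of_injective _ hinj, Set.ncard_eq_toFinset_card']
          rfl
        have hle : (S \ A).ncard ≤ (S \ u '' {2, 4, 6, 8}).ncard :=
          Set.ncard_le_ncard (Set.sdiff_subset_sdiff_right (Set.image_mono (by simp)))
        have hdiff := Set.ncard_sdiff_add_ncard_of_subset hsub
        have hins := Set.ncard_insert_le v (S \ A)
        change (insert v (S \ A)).ncard + 3 ≤ S.ncard
        omega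
      have hRi : ∀ a ∈ R, ∀ b ∈ R, ¬ G.Adj a b := by
        have h4A : u 4 ∈ A := Set.mem_image_of_mem u (by simp)
        have h8A : u 8 ∈ A := Set.mem_image_of_mem u (by simp)
        rintro a (rfl | ⟨ha, haA⟩) b (rfl | ⟨hb, hbA⟩) hab
        · exact G.loopless.irrefl _ hab
        · exact hbA (hA b hb hab)
        · exact haA (hA a ha hab.symm)
        · have hav : a ≠ v := fun h => hvS (h ▸ ha)
          have hbv : b ≠ v := fun h => hvS (h ▸ hb)
          rcases hmiss a b hab (hSi a ha b hb) hav hbv with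
            ⟨rfl, -⟩ | ⟨rfl, -⟩ | ⟨rfl, -⟩ | ⟨rfl, -⟩ <;> contradiction
      have hRd : ∀ y, y ∉ R → (∀ w ∈ R, ¬ G.Adj w y) → G.Adj (u 0) y ∧ y ≠ v ∧ y ≠ u 1 := by
        intro y hyR hy
        have hvy : ¬ G.Adj v y := hy v (Set.mem_insert _ _)
        have hyv : y ≠ v := fun h => hyR (h ▸ Set.mem_insert _ _)
        have hne : ∀ i, y ≠ u i := fun i h => hvy (h ▸ hnbr i)
        refine ⟨?_, hyv, hne 1⟩
        rcases hSd y with hyS | ⟨w, hw, hadj⟩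
        · refine absurd (Or.inr ⟨hyS, ?_⟩) hyR
          rintro ⟨i, -, h⟩
          exact hne i h.symm
        · have hadj' := hHG _ _ hadj
          by_cases hwA : w ∈ A
          · obtain ⟨i, rfl | rfl | rfl | rfl | rfl, rfl⟩ := hwA
            · exact hadj'
            · rcases n2 y hadj' with h | h | h
              exacts [absurd h hyv, absurd h (hne _), absurd h (hne _)]
            · exact absurd hadj (hH4 y)
            · rcases n6 y hadj' with h | h | h
              exacts [absurd h hyv, absurd h (hne _), absurd h (hne _)]
            · exact absurd hadj (hH8 y)
          · exact absurd hadj' (hy w (Set.mem_insert_of_mem v ⟨hw, hwA⟩))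
      by_cases hdom : ∀ y, y ∈ R ∨ ∃ w ∈ R, G.Adj w y
      · exact ⟨R, ⟨hRi, hdom⟩, by omega⟩
      · push Not at hdom
        obtain ⟨y, hyR, hy⟩ := hdom
        obtain ⟨hy0, hyv, hy1⟩ := hRd y hyR hy
        refine ⟨insert y R, ⟨?_, ?_⟩, by have := Set.ncard_insert_le y R; omega⟩
        · rintro a (rfl | ha) b (rfl | hb) hab
          · exact G.loopless.irrefl _ hab
          · exact hy b hb hab.symm
          · exact hy a ha hab
          · exact hRi a ha b hb hab
        · intro z
          by_contra! hz
          have hzR : z ∉ R := fun h => hz.1 (Set.mem_insert_of_mem y h)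
          obtain ⟨hz0, hzv, hz1⟩ := hRd z hzR fun w hw => hz.2 w (Set.mem_insert_of_mem y hw)
          exact hz.1 (n0 y z hy0 hz0 hyv hy1 hzv hz1 ▸ Set.mem_insert _ _)
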